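/- Let {x_i}_{i∈I} and {y_j}_{j∈J} be finite families of points in ℝ^d that are linearly separable. Define the differential-training loss L(w) = Σ_{i∈I} Σ_{j∈J} log(1 + exp(−⟨w, x_i − y_j⟩)) for w ∈ ℝ^d. There exists η₀ > 0 such that for every step size η ∈ (0, η₀) and every initialization w(0) ∈ ℝ^d, the gradient descent iterates w(t+1) = w(t) − η∇L(w(t)) satisfy lim_{t→∞} w(t)/‖w(t)‖ = w_SVM/‖w_SVM‖, where w_SVM is the unique minimizer of ‖w‖² over all w ∈ ℝ^d satisfying ⟨w, x_i − y_j⟩ ≥ 2 for all i∈I and j∈J (the hard-margin SVM solution). -/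

import Mathlib

open scoped RealInnerProductSpace

open Filter Topology

/-- The logistic loss of a margin. -/
noncomputable def logisticLoss (m : ℝ) : ℝ := Real.log (1 + Real.exp (-m))

/-- The negative derivative of the logistic loss. -/
noncomputable def logisticWeight (m : ℝ) : ℝ := Real.exp (-m) / (1 + Real.exp (-m))

lemma logisticLoss_pos (m : ℝ) : 0 < logisticLoss m :=
  Real.log_pos (by linarith [Real.exp_pos (-m)])

lemma logisticWeight_pos (m : ℝ) : 0 < logisticWeight m := by
  unfold logisticWeight; positivity

lemma exp_logisticLoss (m : ℝ) : Real.exp (logisticLoss m) = 1 + Real.exp (-m) :=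
  Real.exp_log (by positivity)

lemma logisticWeight_eq (m : ℝ) : logisticWeight m = 1 - Real.exp (-logisticLoss m) := by
  rw [Real.exp_neg, exp_logisticLoss, logisticWeight]
  field_simp
  ring

lemma logisticWeight_le_one (m : ℝ) : logisticWeight m ≤ 1 := by
  rw [logisticWeight_eq]
  linarith [Real.exp_pos (-logisticLoss m)]

lemma logisticWeight_le_logisticLoss (m : ℝ) : logisticWeight m ≤ logisticLoss m := by
  rw [logisticWeight_eq]
  linarith [Real.add_one_le_exp (-logisticLoss m)]

lemma logisticLoss_sub_sq_le_logisticWeight (m : ℝ) :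
    logisticLoss m - logisticLoss m ^ 2 ≤ logisticWeight m := by
  rw [logisticWeight_eq]
  have h0 := logisticLoss_pos m
  rcases le_total (logisticLoss m) 1 with h | h
  · have := Real.abs_exp_sub_one_sub_id_le (x := -logisticLoss m)
      (by rw [abs_neg, abs_of_pos h0]; exact h)
    nlinarith [(abs_le.1 this).2]
  · have : Real.exp (-logisticLoss m) ≤ 1 := Real.exp_le_one_iff.2 (by linarith)
    nlinarith

lemma logisticLoss_le_two_mul_logisticWeight {m : ℝ} (h : logisticWeight m ≤ 1 / 2) :
    logisticLoss m ≤ 2 * logisticWeight m := by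
  have he := Real.exp_pos (-m)
  have h1 : logisticLoss m ≤ Real.exp (-m) := by
    have := Real.log_le_sub_one_of_pos (x := 1 + Real.exp (-m)) (by positivity)
    unfold logisticLoss
    linarith
  have h2 : logisticWeight m * (1 + Real.exp (-m)) = Real.exp (-m) := by
    unfold logisticWeight
    field_simp
  nlinarith

lemma logisticLoss_add_le (m : ℝ) {δ : ℝ} (hδ : |δ| ≤ 1) :
    logisticLoss (m + δ) ≤ logisticLoss m + logisticWeight m * (-δ + δ ^ 2) := by
  have he := Real.exp_pos (-m)
  have hexp := (abs_le.1 (Real.abs_exp_sub_one_sub_id_le (x := -δ) (by rwa [abs_neg]))).2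
  have hratio : (1 + Real.exp (-(m + δ))) / (1 + Real.exp (-m)) - 1
      = logisticWeight m * (Real.exp (-δ) - 1) := by
    rw [neg_add, Real.exp_add, logisticWeight]
    field_simp
    ring
  have hlog := Real.log_le_sub_one_of_pos
    (x := (1 + Real.exp (-(m + δ))) / (1 + Real.exp (-m))) (by positivity)
  rw [hratio, Real.log_div (by positivity) (by positivity)] at hlog
  have := mul_le_mul_of_nonneg_left
    (show Real.exp (-δ) - 1 ≤ -δ + δ ^ 2 by linarith [neg_sq δ]) (logisticWeight_pos m).le
  unfold logisticLoss
  linarith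

lemma neg_log_two_mul_logisticLoss_le {m : ℝ} (h : logisticLoss m ≤ 1) :
    -Real.log (2 * logisticLoss m) ≤ m := by
  have h0 := logisticLoss_pos m
  have h1 := (abs_le.1 (Real.abs_exp_sub_one_sub_id_le (x := logisticLoss m)
    (by rwa [abs_of_pos h0]))).2
  rw [exp_logisticLoss] at h1
  have : -m ≤ Real.log (2 * logisticLoss m) :=
    (Real.le_log_iff_exp_le (by positivity)).2 (by nlinarith)
  linarith

lemma hasDerivAt_logisticLoss (m : ℝ) : HasDerivAt logisticLoss (-logisticWeight m) m := by
  have := (((hasDerivAt_neg m).exp).const_add 1).log (by positivity)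
  exact this.congr_deriv (by simp [logisticWeight, neg_div])

/-- A sequence whose margins are asymptotically optimal relative to its norm converges in
direction to the minimum-norm vector of margin `2`. -/
lemma tendsto_direction_of_margin {E K : Type*} [NormedAddCommGroup E] [InnerProductSpace ℝ E]
    {z : K → E} {v : E} {w : ℕ → E} (hv0 : v ≠ 0)
    (hv : ∀ k, 2 ≤ ⟪v, z k⟫) (hmin : ∀ u, (∀ k, 2 ≤ ⟪u, z k⟫) → ‖v‖ ≤ ‖u‖)
    (hw : ∀ᶠ t in atTop, w t ≠ 0)
    (hmargin : ∀ ε : ℝ, 0 < ε → ε < 1 →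
      ∀ᶠ t in atTop, ∀ k, 2 / ‖v‖ * (1 - ε) * ‖w t‖ ≤ ⟪w t, z k⟫) :
    Tendsto (fun t => ‖w t‖⁻¹ • w t) atTop (𝓝 (‖v‖⁻¹ • v)) := by
  have hvpos : 0 < ‖v‖ := norm_pos_iff.2 hv0
  -- the first-order optimality condition, obtained by comparing `v` with points of a segment
  have hvar : ∀ u, (∀ k, 2 ≤ ⟪u, z k⟫) → ‖v‖ ^ 2 ≤ ⟪v, u⟫ := by
    intro u hu
    have hconv : Convex ℝ {u : E | ∀ k, 2 ≤ ⟪u, z k⟫} := by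
      intro a ha b hb s t hs ht hst k
      rw [inner_add_left, inner_smul_left, inner_smul_left]
      simp only [RCLike.conj_to_real]
      nlinarith [ha k, hb k]
    have hinf : ‖(0 : E) - v‖ = ⨅ u : {u : E | ∀ k, 2 ≤ ⟪u, z k⟫}, ‖(0 : E) - u‖ := by
      have : Nonempty {u : E | ∀ k, 2 ≤ ⟪u, z k⟫} := ⟨⟨v, hv⟩⟩
      refine le_antisymm (le_ciInf fun u => by simpa using hmin u u.2) ?_
      exact ciInf_le (f := fun u : {u : E | ∀ k, 2 ≤ ⟪u, z k⟫} => ‖(0 : E) - u‖)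
        ⟨0, Set.forall_mem_range.2 fun _ => norm_nonneg _⟩ ⟨v, hv⟩
    have := (norm_eq_iInf_iff_real_inner_le_zero hconv hv).1 hinf u hu
    rw [zero_sub, inner_neg_left, inner_sub_right, real_inner_self_eq_norm_sq] at this
    linarith
  rw [Metric.tendsto_nhds]
  intro e he
  obtain ⟨ε, hε0, hε⟩ := exists_between (show 0 < min 1 (e ^ 2 / 2) by positivity)
  have hε1 : ε < 1 := hε.trans_le (min_le_left _ _)
  filter_upwards [hw, hmargin ε hε0 hε1] with t ht hm
  have ha : 0 < ‖w t‖ := norm_pos_iff.2 ht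
  have hε1' : 0 < 1 - ε := by linarith
  have hinner : (1 - ε) * ‖w t‖ * ‖v‖ ≤ ⟪w t, v⟫ := by
    have := hvar ((‖v‖ / ((1 - ε) * ‖w t‖)) • w t) fun k => by
      rw [inner_smul_left]
      calc (2 : ℝ) = ‖v‖ / ((1 - ε) * ‖w t‖) * (2 / ‖v‖ * (1 - ε) * ‖w t‖) := by field_simp
        _ ≤ _ := mul_le_mul_of_nonneg_left (hm k) (by positivity)
    rw [inner_smul_right, real_inner_comm, div_mul_eq_mul_div, le_div_iff₀ (by positivity)] at this
    nlinarith
  have hnorm : ∀ u : E, 0 < ‖u‖ → ‖‖u‖⁻¹ • u‖ = 1 := fun u hu => by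
    rw [norm_smul, norm_inv, norm_norm, inv_mul_cancel₀ hu.ne']
  have hcos : 1 - ε ≤ ⟪‖w t‖⁻¹ • w t, ‖v‖⁻¹ • v⟫ := by
    rw [inner_smul_left, inner_smul_right]
    calc 1 - ε = ‖w t‖⁻¹ * (‖v‖⁻¹ * ((1 - ε) * ‖w t‖ * ‖v‖)) := by field_simp
      _ ≤ _ := by
        simp only [RCLike.conj_to_real]
        gcongr
  rw [dist_eq_norm]
  refine lt_of_pow_lt_pow_left₀ 2 he.le ?_
  rw [norm_sub_sq_real, hnorm _ ha, hnorm _ hvpos]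
  linarith [hε.trans_le (min_le_right _ _)]

section GradientDescent

variable {E K : Type*} [NormedAddCommGroup E] [InnerProductSpace ℝ E] [Fintype K]

/-- The total logistic loss of the margins `⟪w, z k⟫`. -/
noncomputable def totalLoss (z : K → E) (w : E) : ℝ := ∑ k, logisticLoss ⟪w, z k⟫

/-- The total weight of the margins `⟪w, z k⟫`. -/
noncomputable def totalWeight (z : K → E) (w : E) : ℝ := ∑ k, logisticWeight ⟪w, z k⟫

/-- The negative gradient of `totalLoss`. -/
noncomputable def descentDirection (z : K → E) (w : E) : E :=
  ∑ k, logisticWeight ⟪w, z k⟫ • z k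

lemma gradient_totalLoss [CompleteSpace E] (z : K → E) (w : E) :
    gradient (totalLoss z) w = -descentDirection z w := by
  apply HasGradientAt.gradient
  rw [hasGradientAt_iff_hasFDerivAt]
  have h : ∀ k ∈ Finset.univ, HasFDerivAt (fun w => logisticLoss ⟪w, z k⟫)
      ((-logisticWeight ⟪w, z k⟫) • innerSL ℝ (z k)) w := by
    intro k _
    have h1 : HasFDerivAt (fun w : E => ⟪w, z k⟫) (innerSL ℝ (z k)) w := by
      convert (innerSL ℝ (z k)).hasFDerivAt (x := w) using 1
      ext u
      simp [real_inner_comm]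
    exact (hasDerivAt_logisticLoss _).comp_hasFDerivAt w h1
  have hsum := HasFDerivAt.fun_sum h
  refine hsum.congr_fderiv ?_
  ext u
  simp [descentDirection]

lemma logisticLoss_le_totalLoss (z : K → E) (w : E) (k : K) :
    logisticLoss ⟪w, z k⟫ ≤ totalLoss z w :=
  Finset.single_le_sum (f := fun k => logisticLoss ⟪w, z k⟫)
    (fun _ _ => (logisticLoss_pos _).le) (Finset.mem_univ k)

lemma logisticWeight_le_totalWeight (z : K → E) (w : E) (k : K) :
    logisticWeight ⟪w, z k⟫ ≤ totalWeight z w :=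
  Finset.single_le_sum (f := fun k => logisticWeight ⟪w, z k⟫)
    (fun _ _ => (logisticWeight_pos _).le) (Finset.mem_univ k)

lemma totalWeight_nonneg (z : K → E) (w : E) : 0 ≤ totalWeight z w :=
  Finset.sum_nonneg fun _ _ => (logisticWeight_pos _).le

lemma totalLoss_pos [Nonempty K] (z : K → E) (w : E) : 0 < totalLoss z w :=
  Finset.sum_pos (fun _ _ => logisticLoss_pos _) Finset.univ_nonempty

lemma totalWeight_le_card (z : K → E) (w : E) : totalWeight z w ≤ Fintype.card K := by
  simpa [totalWeight] using Finset.sum_le_sum fun k (_ : k ∈ Finset.univ) => logisticWeight_le_one ⟪w, z k⟫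

lemma totalLoss_le_two_mul_totalWeight (z : K → E) {w : E} (h : totalWeight z w ≤ 1 / 2) :
    totalLoss z w ≤ 2 * totalWeight z w := by
  rw [totalWeight, Finset.mul_sum]
  exact Finset.sum_le_sum fun k _ =>
    logisticLoss_le_two_mul_logisticWeight ((logisticWeight_le_totalWeight z w k).trans h)

lemma totalLoss_mul_one_sub_le_totalWeight (z : K → E) (w : E) :
    totalLoss z w * (1 - totalLoss z w) ≤ totalWeight z w := by
  calc totalLoss z w * (1 - totalLoss z w)
      = ∑ k, logisticLoss ⟪w, z k⟫ * (1 - totalLoss z w) := by rw [← Finset.sum_mul, totalLoss]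
    _ ≤ totalWeight z w := Finset.sum_le_sum fun k _ => by
        nlinarith [logisticLoss_sub_sq_le_logisticWeight ⟪w, z k⟫,
          logisticLoss_le_totalLoss z w k, logisticLoss_pos ⟪w, z k⟫]

lemma norm_descentDirection_le {z : K → E} {R : ℝ} (hR : ∀ k, ‖z k‖ ≤ R) (w : E) :
    ‖descentDirection z w‖ ≤ R * totalWeight z w := by
  refine (norm_sum_le _ _).trans ?_
  rw [totalWeight, Finset.mul_sum]
  refine Finset.sum_le_sum fun k _ => ?_
  rw [norm_smul, Real.norm_of_nonneg (logisticWeight_pos _).le, mul_comm]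
  exact mul_le_mul_of_nonneg_right (hR k) (logisticWeight_pos _).le

lemma two_mul_totalWeight_le {z : K → E} {v : E} (hv : ∀ k, 2 ≤ ⟪v, z k⟫) (w : E) :
    2 * totalWeight z w ≤ ‖v‖ * ‖descentDirection z w‖ := by
  refine le_trans ?_ (real_inner_le_norm v (descentDirection z w))
  rw [descentDirection, inner_sum, totalWeight, Finset.mul_sum]
  refine Finset.sum_le_sum fun k _ => ?_
  rw [inner_smul_right, mul_comm]
  exact mul_le_mul_of_nonneg_left (hv k) (logisticWeight_pos _).le

lemma totalLoss_descent_le {z : K → E} {R η : ℝ} (hR0 : 0 ≤ R) (hR : ∀ k, ‖z k‖ ≤ R)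
    (hη : 0 ≤ η) (hηR : η * R ^ 2 * Fintype.card K ≤ 1) (w : E) :
    totalLoss z (w + η • descentDirection z w) ≤
      totalLoss z w
        - η * ‖descentDirection z w‖ ^ 2 * (1 - η * R ^ 2 * totalWeight z w) := by
  set g := descentDirection z w with hg
  have hgz : ∀ k, |⟪g, z k⟫| ≤ ‖g‖ * R := fun k =>
    (abs_real_inner_le_norm _ _).trans (mul_le_mul_of_nonneg_left (hR k) (norm_nonneg _))
  have hδ : ∀ k, |η * ⟪g, z k⟫| ≤ 1 := by
    intro k
    rw [abs_mul, abs_of_nonneg hη]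
    calc η * |⟪g, z k⟫| ≤ η * ((R * Fintype.card K) * R) := by
          have h1 : ‖g‖ ≤ R * Fintype.card K := (norm_descentDirection_le hR w).trans
            (mul_le_mul_of_nonneg_left (totalWeight_le_card z w) hR0)
          gcongr
          exact (hgz k).trans (mul_le_mul_of_nonneg_right h1 hR0)
      _ ≤ 1 := by linarith
  have hterm : ∀ k, logisticLoss ⟪w + η • g, z k⟫ ≤ logisticLoss ⟪w, z k⟫
      - η * (logisticWeight ⟪w, z k⟫ * ⟪g, z k⟫)
      + logisticWeight ⟪w, z k⟫ * (η * ‖g‖ * R) ^ 2 := by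
    intro k
    rw [inner_add_left, inner_smul_left]
    have h1 := logisticLoss_add_le ⟪w, z k⟫ (hδ k)
    have h2 : (η * ⟪g, z k⟫) ^ 2 ≤ (η * ‖g‖ * R) ^ 2 := by
      rw [← sq_abs (η * ⟪g, z k⟫), abs_mul, abs_of_nonneg hη, mul_assoc]
      refine pow_le_pow_left₀ (by positivity) ?_ 2
      exact mul_le_mul_of_nonneg_left (hgz k) hη
    have h3 := mul_le_mul_of_nonneg_left h2 (logisticWeight_pos ⟪w, z k⟫).le
    simp only [RCLike.conj_to_real]
    linarith
  have hgg : ∑ k, logisticWeight ⟪w, z k⟫ * ⟪g, z k⟫ = ‖g‖ ^ 2 := by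
    rw [← real_inner_self_eq_norm_sq]
    conv_rhs => rw [hg, descentDirection, inner_sum]
    simp [inner_smul_right, hg, descentDirection]
  calc totalLoss z (w + η • g)
      ≤ ∑ k, (logisticLoss ⟪w, z k⟫ - η * (logisticWeight ⟪w, z k⟫ * ⟪g, z k⟫)
          + logisticWeight ⟪w, z k⟫ * (η * ‖g‖ * R) ^ 2) := Finset.sum_le_sum fun k _ => hterm k
    _ = totalLoss z w - η * ‖g‖ ^ 2 + totalWeight z w * (η * ‖g‖ * R) ^ 2 := by
        rw [Finset.sum_add_distrib, Finset.sum_sub_distrib, ← Finset.mul_sum, ← Finset.sum_mul,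
          hgg, totalLoss, totalWeight]
    _ = _ := by ring

/-- Gradient descent on the logistic loss with a small step size converges in direction to the
minimum-norm vector of margin `2`. -/
theorem tendsto_direction_of_descent [Nonempty K] {z : K → E} {v : E} {w : ℕ → E} {R η : ℝ}
    (hR0 : 0 < R) (hR : ∀ k, ‖z k‖ ≤ R) (hη : 0 < η)
    (hηR : η * R ^ 2 * Fintype.card K ≤ 1 / 2)
    (hstep : ∀ t, w (t + 1) = w t + η • descentDirection z (w t))
    (hv : ∀ k, 2 ≤ ⟪v, z k⟫) (hmin : ∀ u, (∀ k, 2 ≤ ⟪u, z k⟫) → ‖v‖ ≤ ‖u‖) :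
    Tendsto (fun t => ‖w t‖⁻¹ • w t) atTop (𝓝 (‖v‖⁻¹ • v)) := by
  have hv0 : v ≠ 0 := by
    rintro rfl
    have := hv (Classical.arbitrary K)
    rw [inner_zero_left] at this
    linarith
  have hvpos : 0 < ‖v‖ := norm_pos_iff.2 hv0
  set ℓ : ℕ → ℝ := fun t => totalLoss z (w t) with hℓ
  set P : ℕ → ℝ := fun t => totalWeight z (w t) with hP
  set g : ℕ → ℝ := fun t => ‖descentDirection z (w t)‖ with hg
  have hℓpos : ∀ t, 0 < ℓ t := fun t => totalLoss_pos z (w t)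
  have hg0 : ∀ t, 0 ≤ g t := fun t => norm_nonneg _
  have hPg : ∀ t, 2 / ‖v‖ * P t ≤ g t := fun t => by
    rw [div_mul_eq_mul_div, div_le_iff₀ hvpos, mul_comm (g t)]
    exact two_mul_totalWeight_le hv (w t)
  have hdescent : ∀ t, ℓ (t + 1) ≤ ℓ t - η * g t ^ 2 * (1 - η * R ^ 2 * P t) := fun t => by
    have := totalLoss_descent_le hR0.le hR hη.le (hηR.trans (by norm_num)) (w t)
    rwa [← hstep] at this
  have hhalf : ∀ t, η * R ^ 2 * P t ≤ 1 / 2 := fun t =>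
    (mul_le_mul_of_nonneg_left (totalWeight_le_card z (w t)) (by positivity)).trans hηR
  have hdescent' : ∀ t, η / 2 * g t ^ 2 ≤ ℓ t - ℓ (t + 1) := fun t => by
    have h1 : 0 ≤ η * g t ^ 2 := by positivity
    nlinarith [hdescent t, hhalf t]
  have hanti : Antitone ℓ := antitone_nat_of_succ_le fun t => by
    have h1 : 0 ≤ η / 2 * g t ^ 2 := by positivity
    linarith [hdescent' t]
  have hgsq : Tendsto (fun t => g t ^ 2) atTop (𝓝 0) := by
    have hlim := tendsto_atTop_ciInf hanti ⟨0, Set.forall_mem_range.2 fun t => (hℓpos t).le⟩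
    have hdiff := (hlim.sub (hlim.comp (tendsto_add_atTop_nat 1))).const_mul (2 / η)
    rw [sub_self, mul_zero] at hdiff
    refine squeeze_zero (fun t => sq_nonneg _) (fun t => ?_) hdiff
    calc g t ^ 2 = 2 / η * (η / 2 * g t ^ 2) := by field_simp
      _ ≤ _ := mul_le_mul_of_nonneg_left (hdescent' t) (by positivity)
  have hglim : Tendsto g atTop (𝓝 0) := by
    have := hgsq.sqrt
    rw [Real.sqrt_zero] at this
    exact this.congr fun t => Real.sqrt_sq (hg0 t)
  have hPlim : Tendsto P atTop (𝓝 0) := by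
    have := hglim.const_mul (‖v‖ / 2)
    rw [mul_zero] at this
    refine squeeze_zero (fun t => totalWeight_nonneg z (w t)) (fun t => ?_) this
    calc P t = ‖v‖ / 2 * (2 / ‖v‖ * P t) := by field_simp
      _ ≤ _ := mul_le_mul_of_nonneg_left (hPg t) (by positivity)
  have hℓlim : Tendsto ℓ atTop (𝓝 0) := by
    have := hPlim.const_mul 2
    rw [mul_zero] at this
    refine squeeze_zero' (.of_forall fun t => (hℓpos t).le) ?_ this
    filter_upwards [hPlim.eventually_le_const (show (0 : ℝ) < 1 / 2 by norm_num)] with t ht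
    exact totalLoss_le_two_mul_totalWeight z ht
  have hloglim : Tendsto (fun t => -Real.log (ℓ t)) atTop atTop :=
    tendsto_neg_atBot_atTop.comp (Real.tendsto_log_nhdsGT_zero.comp
      (tendsto_nhdsWithin_iff.2 ⟨hℓlim, .of_forall hℓpos⟩))
  have hmargin : ∀ᶠ t in atTop, ∀ k, -Real.log (ℓ t) - Real.log 2 ≤ ⟪w t, z k⟫ := by
    filter_upwards [hℓlim.eventually_le_const one_pos] with t ht k
    have h1 := logisticLoss_le_totalLoss z (w t) k
    have h2 := logisticLoss_pos ⟪w t, z k⟫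
    have h3 := neg_log_two_mul_logisticLoss_le (h1.trans ht)
    rw [Real.log_mul two_ne_zero h2.ne'] at h3
    linarith [Real.log_le_log h2 h1]
  have hwlim : Tendsto (fun t => ‖w t‖) atTop atTop := by
    have h1 : Tendsto (fun t => (-Real.log (ℓ t) - Real.log 2) / R) atTop atTop :=
      (tendsto_atTop_add_const_right _ _ hloglim).atTop_div_const hR0
    refine tendsto_atTop_mono' _ ?_ h1
    filter_upwards [hmargin] with t ht
    have k := Classical.arbitrary K
    rw [div_le_iff₀ hR0]
    exact (ht k).trans ((real_inner_le_norm _ _).trans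
      (mul_le_mul_of_nonneg_left (hR k) (norm_nonneg _)))
  refine tendsto_direction_of_margin hv0 hv hmin
    ((hwlim.eventually_gt_atTop 0).mono fun t ht => norm_pos_iff.1 ht) fun ε hε0 hε1 => ?_
  -- eventually `-log (ℓ t)` grows at least `2 / ‖v‖ * (1 - ε / 2)` times as fast as `‖w t‖`
  have hfactor : ∀ᶠ t in atTop, 1 - ε / 2 ≤ (1 - ℓ t) * (1 - η * R ^ 2 * P t) := by
    have h1 : Tendsto (fun t => (1 - ℓ t) * (1 - η * R ^ 2 * P t)) atTop
        (𝓝 ((1 - 0) * (1 - η * R ^ 2 * 0))) :=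
      (hℓlim.const_sub 1).mul ((hPlim.const_mul _).const_sub 1)
    exact h1.eventually_const_le (by linarith)
  obtain ⟨T, hT⟩ := eventually_atTop.1 hfactor
  set c : ℝ := 2 / ‖v‖ * (1 - ε / 2) with hc
  have hc0 : 0 ≤ c := mul_nonneg (by positivity) (by linarith)
  have hgrow : ∀ t ≥ T, c * ‖w t‖ + Real.log (ℓ t) ≤ c * ‖w T‖ + Real.log (ℓ T) := by
    intro t ht
    induction t, ht using Nat.le_induction with
    | base => rfl
    | succ t ht ih =>
      have hnorm : ‖w (t + 1)‖ ≤ ‖w t‖ + η * g t := by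
        rw [hstep]
        refine (norm_add_le _ _).trans_eq ?_
        rw [norm_smul, Real.norm_of_nonneg hη.le]
      have hweight : ℓ t * (1 - ε / 2) ≤ P t * (1 - η * R ^ 2 * P t) :=
        calc ℓ t * (1 - ε / 2) ≤ ℓ t * ((1 - ℓ t) * (1 - η * R ^ 2 * P t)) :=
              mul_le_mul_of_nonneg_left (hT t ht) (hℓpos t).le
          _ = (ℓ t * (1 - ℓ t)) * (1 - η * R ^ 2 * P t) := by ring
          _ ≤ _ := mul_le_mul_of_nonneg_right (totalLoss_mul_one_sub_le_totalWeight z (w t))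
              (by linarith [hhalf t])
      have hdrop : ℓ t * (c * (η * g t)) ≤ ℓ t - ℓ (t + 1) :=
        calc ℓ t * (c * (η * g t)) = η * g t * (2 / ‖v‖) * (ℓ t * (1 - ε / 2)) := by
              rw [hc]; ring
          _ ≤ η * g t * (2 / ‖v‖) * (P t * (1 - η * R ^ 2 * P t)) :=
              mul_le_mul_of_nonneg_left hweight
                (mul_nonneg (mul_nonneg hη.le (hg0 t)) (by positivity))
          _ = η * g t * (1 - η * R ^ 2 * P t) * (2 / ‖v‖ * P t) := by ring
          _ ≤ η * g t * (1 - η * R ^ 2 * P t) * g t :=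
              mul_le_mul_of_nonneg_left (hPg t)
                (mul_nonneg (mul_nonneg hη.le (hg0 t)) (by linarith [hhalf t]))
          _ ≤ ℓ t - ℓ (t + 1) := by linarith [hdescent t]
      have hlog : Real.log (ℓ (t + 1)) - Real.log (ℓ t) ≤ -(c * (η * g t)) := by
        rw [← Real.log_div (hℓpos _).ne' (hℓpos _).ne']
        refine (Real.log_le_sub_one_of_pos (div_pos (hℓpos _) (hℓpos _))).trans ?_
        rw [sub_le_iff_le_add, div_le_iff₀ (hℓpos t)]
        linarith
      linarith [mul_le_mul_of_nonneg_left hnorm hc0]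
  have hlarge := (hwlim.const_mul_atTop
    (show 0 < 2 / ‖v‖ * (ε / 2) by positivity)).eventually_ge_atTop (c * ‖w T‖ + Real.log (ℓ T) + Real.log 2)
  filter_upwards [eventually_ge_atTop T, hmargin, hlarge] with t ht hm hl k
  linarith [hgrow t ht, hm k, show 2 / ‖v‖ * (1 - ε) * ‖w t‖
    = c * ‖w t‖ - 2 / ‖v‖ * (ε / 2) * ‖w t‖ by rw [hc]; ring]

end GradientDescent

/-- **Theorem 2.** Let `x i`, `y j` be linearly separable points in `ℝ^d`. For every
sufficiently small step size, the gradient descent iterates on the differential-training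
loss `L(w) = ∑ᵢ ∑ⱼ log(1 + exp(-⟪w, x i - y j⟫))`, from any initialization, converge in
direction to `w_SVM/‖w_SVM‖`, where `w_SVM` is the minimum-norm vector satisfying
`⟪w, x i - y j⟫ ≥ 2` for all `i, j` (the hard-margin SVM solution). -/
theorem differential_training_converges_to_svm
    {d : ℕ} {I J : Type*} [Fintype I] [Fintype J] [Nonempty I] [Nonempty J]
    (x : I → EuclideanSpace ℝ (Fin d)) (y : J → EuclideanSpace ℝ (Fin d))
    (hsep : ∃ (w : EuclideanSpace ℝ (Fin d)) (b : ℝ),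
      (∀ i, 0 < ⟪w, x i⟫ + b) ∧ (∀ j, ⟪w, y j⟫ + b < 0))
    (L : EuclideanSpace ℝ (Fin d) → ℝ)
    (hL : ∀ w, L w = ∑ i, ∑ j, Real.log (1 + Real.exp (-⟪w, x i - y j⟫))) :
    ∃ η₀ > (0 : ℝ), ∀ η : ℝ, 0 < η → η < η₀ →
      ∀ w : ℕ → EuclideanSpace ℝ (Fin d),
        (∀ t, w (t + 1) = w t - η • gradient L (w t)) →
        ∀ wSVM : EuclideanSpace ℝ (Fin d),
          (∀ i j, 2 ≤ ⟪wSVM, x i - y j⟫) →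
          (∀ w' : EuclideanSpace ℝ (Fin d),
            (∀ i j, 2 ≤ ⟪w', x i - y j⟫) → ‖wSVM‖ ^ 2 ≤ ‖w'‖ ^ 2) →
          Filter.Tendsto (fun t => ‖w t‖⁻¹ • w t) Filter.atTop
            (nhds (‖wSVM‖⁻¹ • wSVM)) := by
  set z : I × J → EuclideanSpace ℝ (Fin d) := fun k => x k.1 - y k.2 with hz
  have hLz : L = totalLoss z := by
    ext w
    rw [hL, totalLoss, Fintype.sum_prod_type]
    rfl
  set R : ℝ := 1 + ∑ k, ‖z k‖ with hRdef
  have hR0 : 0 < R := by positivity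
  have hR : ∀ k, ‖z k‖ ≤ R := fun k => by
    linarith [Finset.single_le_sum (f := fun k => ‖z k‖) (fun _ _ => norm_nonneg _)
      (Finset.mem_univ k)]
  have hcard : (0 : ℝ) < Fintype.card (I × J) := by exact_mod_cast Fintype.card_pos
  refine ⟨1 / 2 / (R ^ 2 * Fintype.card (I × J)), by positivity, ?_⟩
  intro η hη hη₀ w hw v hv hmin
  rw [lt_div_iff₀ (by positivity), ← mul_assoc] at hη₀
  refine tendsto_direction_of_descent (z := z) hR0 hR hη hη₀.le (fun t => ?_)
    (fun k => hv k.1 k.2) fun u hu => ?_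
  · rw [hw, hLz, gradient_totalLoss, smul_neg, sub_neg_eq_add]
  · exact le_of_sq_le_sq (hmin u fun i j => hu (i, j)) (norm_nonneg u)
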